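/- Let V be a nonempty finite set and let (·,·) be a negative definite symmetric ℤ-valued bilinear form on L := ℤ^V with standard basis {E_v}_{v∈V}, satisfying (E_u,E_v) ≥ 0 for u ≠ v; let the dual graph G (edge between u ≠ v iff (E_u,E_v) > 0) be connected; let Z_K ∈ ℚ^V be the unique vector with (Z_K,E_v) = (E_v,E_v)+2 for all v, and χ(x) := −(x, x−Z_K)/2. Fix l' with (l',E_v) a nonnegative integer for every v, fix a cycle Z ∈ L with all coordinates ≥ 1, and assume there exists 0 < l ≤ Z with χ(−l'+l) ≤ χ(−l'). Let Z' be a ≤-minimal element of the set of cycles 0 < Z' ≤ Z realizing the maximum t(Z,l') = max_{0<Z''≤Z} Σ_i T(Z''_i,l'). Then for every connected component Z'_i of Z' one has χ(Z'_i) = min_{0≤l≤Z'_i} χ(l). -/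

import Mathlib

open Classical

noncomputable section

/-- The rational pairing on `ℚ^V` determined by the integral matrix `M`. -/
def pairQ {V : Type} [Fintype V] (M : Matrix V V ℤ) (x y : V → ℚ) : ℚ :=
  ∑ u, ∑ v, x u * (M u v : ℚ) * y v

/-- The Riemann–Roch expression `χ(x) = −(x, x − Z_K)/2`. -/
def chiQ {V : Type} [Fintype V] (M : Matrix V V ℤ) (ZK : V → ℚ) (x : V → ℚ) : ℚ :=
  - pairQ M x (x - ZK) / 2

/-- Inclusion of integral cycles into `ℚ^V`. -/
def toQ {V : Type} (l : V → ℤ) : V → ℚ := fun v => (l v : ℚ)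

/-- The dual graph: `u ~ v` iff `u ≠ v` and `M u v > 0` (for symmetric `M`). -/
def dualGraph {V : Type} (M : Matrix V V ℤ) : SimpleGraph V :=
  SimpleGraph.fromRel (fun u v => 0 < M u v)

/-- The support `|Z|` of a cycle. -/
def supp {V : Type} (Z : V → ℤ) : Set V := {v | Z v ≠ 0}

/-- The dual graph induced on the support of a cycle. -/
def inducedOnSupp {V : Type} (M : Matrix V V ℤ) (Z : V → ℤ) :
    SimpleGraph (supp Z) :=
  (dualGraph M).induce (supp Z)

/-- The part `Z_c` of a cycle `Z` corresponding to a connected component `c`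
of the dual graph induced on the support of `Z`:  it agrees with `Z` on the
component and vanishes elsewhere. -/
def compCycle {V : Type} (M : Matrix V V ℤ) (Z : V → ℤ)
    (c : (inducedOnSupp M Z).ConnectedComponent) : V → ℤ := fun v =>
  if h : Z v ≠ 0 then
    (if (inducedOnSupp M Z).connectedComponentMk ⟨v, h⟩ = c then Z v else 0)
  else 0

/-- The sum `Σ_i F(Z_i)` of a quantity `F` over the connected components
`Z = Σ_i Z_i` of a cycle. -/
def sumComp {V : Type} [Fintype V] (M : Matrix V V ℤ)
    (F : (V → ℤ) → ℚ) (Z : V → ℤ) : ℚ :=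
  ∑ᶠ c : (inducedOnSupp M Z).ConnectedComponent, F (compCycle M Z c)

end

section Pairing

variable {V : Type} [Fintype V] (M : Matrix V V ℤ)

lemma pairQ_add_left (x y z : V → ℚ) : pairQ M (x + y) z = pairQ M x z + pairQ M y z := by
  simp [pairQ, add_mul, Finset.sum_add_distrib]

lemma pairQ_add_right (x y z : V → ℚ) : pairQ M x (y + z) = pairQ M x y + pairQ M x z := by
  simp [pairQ, mul_add, Finset.sum_add_distrib]

lemma pairQ_neg_left (x y : V → ℚ) : pairQ M (-x) y = -pairQ M x y := by
  simp [pairQ]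

lemma pairQ_neg_right (x y : V → ℚ) : pairQ M x (-y) = -pairQ M x y := by
  simp [pairQ]

lemma pairQ_comm (hsym : ∀ u v, M u v = M v u) (x y : V → ℚ) :
    pairQ M x y = pairQ M y x := by
  unfold pairQ
  rw [Finset.sum_comm]
  refine Finset.sum_congr rfl fun u _ => Finset.sum_congr rfl fun v _ => ?_
  rw [hsym v u]
  ring

lemma pairQ_sum_left {ι : Type*} (s : Finset ι) (f : ι → V → ℚ) (y : V → ℚ) :
    pairQ M (∑ i ∈ s, f i) y = ∑ i ∈ s, pairQ M (f i) y := by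
  simp only [pairQ, Finset.sum_apply, Finset.sum_mul]
  simp only [Finset.sum_comm (t := s)]

lemma pairQ_single_right [DecidableEq V] (x : V → ℚ) (v : V) :
    pairQ M x (Pi.single v 1) = ∑ u, x u * (M u v : ℚ) := by
  simp [pairQ, Pi.single_apply]

lemma pairQ_nonneg [DecidableEq V] {x y : V → ℚ}
    (hx : ∀ v, 0 ≤ pairQ M x (Pi.single v 1)) (hy : ∀ v, 0 ≤ y v) : 0 ≤ pairQ M x y := by
  unfold pairQ
  rw [Finset.sum_comm]
  refine Finset.sum_nonneg fun v _ => ?_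
  rw [← Finset.sum_mul, ← pairQ_single_right]
  exact mul_nonneg (hx v) (hy v)

lemma chiQ_add (hsym : ∀ u v, M u v = M v u) (ZK x y : V → ℚ) :
    chiQ M ZK (x + y) = chiQ M ZK x + chiQ M ZK y - pairQ M x y := by
  simp only [chiQ, sub_eq_add_neg, pairQ_add_left, pairQ_add_right, pairQ_comm M hsym y x]
  ring

end Pairing

section Components

variable {V : Type} (M : Matrix V V ℤ)

/-- `u` and `v` are joined by a path of the dual graph inside the support of `Z`. -/
def Linked (Z : V → ℤ) : V → V → Prop :=
  Relation.ReflTransGen fun a b => (dualGraph M).Adj a b ∧ Z a ≠ 0 ∧ Z b ≠ 0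

lemma Linked.symm {Z : V → ℤ} {u v : V} (h : Linked M Z u v) : Linked M Z v u := by
  induction h with
  | refl => exact Relation.ReflTransGen.refl
  | tail _ hbc ih => exact ih.head ⟨hbc.1.symm, hbc.2.2, hbc.2.1⟩

/-- The restriction of `Z` to the connected component of its support through `v`. -/
noncomputable def piece (Z : V → ℤ) (v u : V) : ℤ := if Linked M Z v u then Z u else 0

lemma piece_self (Z : V → ℤ) (v : V) : piece M Z v v = Z v :=
  if_pos Relation.ReflTransGen.refl

lemma linked_of_piece_ne_zero {Z : V → ℤ} {v u : V} (h : piece M Z v u ≠ 0) :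
    Linked M Z v u := by
  by_contra hn
  exact h (if_neg hn)

lemma piece_ne_zero {Z : V → ℤ} {v u : V} (h : piece M Z v u ≠ 0) : Z u ≠ 0 := by
  rwa [piece, if_pos (linked_of_piece_ne_zero M h)] at h

lemma piece_nonneg {Z : V → ℤ} (hZ : 0 ≤ Z) (v : V) : 0 ≤ piece M Z v := by
  intro u
  unfold piece
  split_ifs
  exacts [hZ u, le_rfl]

lemma piece_le {Z : V → ℤ} (hZ : 0 ≤ Z) (v : V) : piece M Z v ≤ Z := by
  intro u
  unfold piece
  split_ifs
  exacts [le_rfl, hZ u]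

lemma sub_piece_apply (Z : V → ℤ) (v u : V) :
    piece M Z v u = 0 ∨ (Z - piece M Z v) u = 0 := by
  by_cases h : Linked M Z v u <;> simp [piece, h]

lemma connectedComponentMk_eq_iff_linked {Z : V → ℤ} {u v : V} (hu : Z u ≠ 0) (hv : Z v ≠ 0) :
    (inducedOnSupp M Z).connectedComponentMk ⟨u, hu⟩ =
      (inducedOnSupp M Z).connectedComponentMk ⟨v, hv⟩ ↔ Linked M Z v u := by
  rw [eq_comm, SimpleGraph.ConnectedComponent.eq, SimpleGraph.reachable_iff_reflTransGen]
  constructor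
  · intro h
    exact Relation.ReflTransGen.lift Subtype.val (fun a b hab => ⟨hab, a.2, b.2⟩) _ _ h
  · intro h
    induction h with
    | refl => exact Relation.ReflTransGen.refl
    | tail _ hbc ih => exact (ih hbc.2.1).tail hbc.1

lemma compCycle_mk {Z : V → ℤ} {v : V} (hv : Z v ≠ 0) :
    compCycle M Z ((inducedOnSupp M Z).connectedComponentMk ⟨v, hv⟩) = piece M Z v := by
  funext u
  by_cases hu : Z u = 0
  · simp [compCycle, piece, hu]
  · simp only [compCycle, piece, dif_pos hu, connectedComponentMk_eq_iff_linked M hu hv]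

lemma exists_compCycle_eq_piece (Z : V → ℤ) (c : (inducedOnSupp M Z).ConnectedComponent) :
    ∃ v, Z v ≠ 0 ∧ compCycle M Z c = piece M Z v := by
  induction c using SimpleGraph.ConnectedComponent.ind with
  | h v => exact ⟨v.1, v.2, compCycle_mk M v.2⟩

lemma compCycle_injective (Z : V → ℤ) : Function.Injective (compCycle M Z) := by
  intro c d h
  induction c using SimpleGraph.ConnectedComponent.ind with
  | h v =>
    have hv : compCycle M Z d v.1 = Z v.1 := by
      rw [← h, compCycle_mk M v.2, piece_self]
    by_contra hne
    have hvz : Z v.1 ≠ 0 := v.2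
    rw [compCycle, dif_pos hvz, if_neg hne] at hv
    exact hvz hv.symm

lemma range_compCycle (Z : V → ℤ) :
    Set.range (compCycle M Z) = {W | ∃ v, Z v ≠ 0 ∧ W = piece M Z v} := by
  ext W
  constructor
  · rintro ⟨c, rfl⟩
    exact exists_compCycle_eq_piece M Z c
  · rintro ⟨v, hv, rfl⟩
    exact ⟨_, compCycle_mk M hv⟩

lemma finite_range_compCycle [Finite V] (Z : V → ℤ) : (Set.range (compCycle M Z)).Finite :=
  Set.finite_range _

lemma sumComp_eq_finsum_mem_range [Fintype V] (F : (V → ℤ) → ℚ) (Z : V → ℤ) :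
    sumComp M F Z = ∑ᶠ W ∈ Set.range (compCycle M Z), F W :=
  (finsum_mem_range (compCycle_injective M Z)).symm

/-- The cycles `x` and `y` have disjoint supports not joined by an edge of the dual graph. -/
def Separated (x y : V → ℤ) : Prop :=
  (∀ u, x u = 0 ∨ y u = 0) ∧ ∀ u v, x u ≠ 0 → y v ≠ 0 → ¬ (dualGraph M).Adj u v

variable {M}

lemma Separated.symm {x y : V → ℤ} (h : Separated M x y) : Separated M y x :=
  ⟨fun u => (h.1 u).symm, fun u v hu hv huv => h.2 v u hv hu huv.symm⟩

lemma Separated.piece_add {x y : V → ℤ} (h : Separated M x y) {v : V} (hv : x v ≠ 0) :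
    piece M (x + y) v = piece M x v := by
  have hlink : ∀ u, Linked M (x + y) v u → Linked M x v u ∧ x u ≠ 0 := by
    intro u hu
    induction hu with
    | refl => exact ⟨Relation.ReflTransGen.refl, hv⟩
    | @tail b c _ hbc ih =>
      have hc : x c ≠ 0 := by
        intro hc
        refine h.2 b c ih.2 (fun hy => hbc.2.2 ?_) hbc.1
        simp [hc, hy]
      exact ⟨ih.1.tail ⟨hbc.1, ih.2, hc⟩, hc⟩
  have hx : ∀ u, x u ≠ 0 → (x + y) u = x u := fun u hu => by
    simp [(h.1 u).resolve_left hu]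
  funext u
  by_cases hu : Linked M (x + y) v u
  · have h' := hlink u hu
    rw [piece, piece, if_pos hu, if_pos h'.1, hx u h'.2]
  · have hu' : ¬ Linked M x v u := by
      refine fun hl => hu (Relation.ReflTransGen.mono (fun a b hab => ⟨hab.1, ?_, ?_⟩) v u hl)
      · rw [hx a hab.2.1]; exact hab.2.1
      · rw [hx b hab.2.2]; exact hab.2.2
    rw [piece, piece, if_neg hu, if_neg hu']

lemma Separated.sumComp_add [Fintype V] {x y : V → ℤ} (h : Separated M x y)
    (F : (V → ℤ) → ℚ) : sumComp M F (x + y) = sumComp M F x + sumComp M F y := by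
  have hrange : Set.range (compCycle M (x + y)) =
      Set.range (compCycle M x) ∪ Set.range (compCycle M y) := by
    simp only [range_compCycle]
    ext W
    constructor
    · rintro ⟨v, hv, rfl⟩
      by_cases hx : x v = 0
      · have hy : y v ≠ 0 := fun hy => hv (by simp [hx, hy])
        exact Or.inr ⟨v, hy, by rw [add_comm, h.symm.piece_add hy]⟩
      · exact Or.inl ⟨v, hx, h.piece_add hx⟩
    · rintro (⟨v, hv, rfl⟩ | ⟨v, hv, rfl⟩)
      · exact ⟨v, by simp [(h.1 v).resolve_left hv, hv], (h.piece_add hv).symm⟩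
      · exact ⟨v, by simp [(h.1 v).resolve_right hv, hv],
          by rw [add_comm, h.symm.piece_add hv]⟩
  have hdisj : Disjoint (Set.range (compCycle M x)) (Set.range (compCycle M y)) := by
    simp only [range_compCycle]
    rw [Set.disjoint_left]
    rintro W ⟨v, hv, rfl⟩ ⟨w, hw, hvw⟩
    refine hv ((h.1 v).resolve_right (piece_ne_zero M (v := w) ?_))
    rwa [← hvw, piece_self]
  simp only [sumComp_eq_finsum_mem_range]
  rw [hrange, finsum_mem_union hdisj (finite_range_compCycle M x) (finite_range_compCycle M y)]

lemma separated_sub_piece (Z : V → ℤ) (v : V) {l : V → ℤ}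
    (hl : ∀ u, piece M Z v u = 0 → l u = 0) : Separated M (Z - piece M Z v) l := by
  constructor
  · intro u
    exact (sub_piece_apply M Z v u).symm.imp_right (hl u)
  · intro a b ha hb hab
    have hb' : piece M Z v b ≠ 0 := fun h => hb (hl b h)
    have ha' : piece M Z v a = 0 := (sub_piece_apply M Z v a).resolve_right ha
    have haZ : Z a ≠ 0 := by simpa [ha'] using ha
    have hlink : Linked M Z v a :=
      (linked_of_piece_ne_zero M hb').tail ⟨hab.symm, piece_ne_zero M hb', haZ⟩
    exact haZ (by rwa [piece, if_pos hlink] at ha')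

lemma piece_piece {Z : V → ℤ} {v w : V} (hw : piece M Z v w ≠ 0) :
    piece M (piece M Z v) w = piece M Z v := by
  have key : ∀ u, Linked M Z v u → Linked M (piece M Z v) v u := by
    intro u hu
    induction hu with
    | refl => exact Relation.ReflTransGen.refl
    | @tail b c hb hbc ih =>
      refine ih.tail ⟨hbc.1, ?_, ?_⟩
      · rw [piece, if_pos (show Linked M Z v b from hb)]; exact hbc.2.1
      · rw [piece, if_pos (show Linked M Z v c from hb.tail hbc)]; exact hbc.2.2
  funext u
  by_cases hu : piece M Z v u = 0
  · rw [piece, hu, ite_self]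
  · exact if_pos (((key w (linked_of_piece_ne_zero M hw)).symm).trans
      (key u (linked_of_piece_ne_zero M hu)))

lemma sumComp_piece [Fintype V] (F : (V → ℤ) → ℚ) {Z : V → ℤ} {v : V} (hv : Z v ≠ 0) :
    sumComp M F (piece M Z v) = F (piece M Z v) := by
  have hrange : Set.range (compCycle M (piece M Z v)) = {piece M Z v} := by
    rw [range_compCycle]
    ext W
    constructor
    · rintro ⟨w, hw, rfl⟩
      exact piece_piece hw
    · rintro rfl
      have hvv : piece M Z v v ≠ 0 := by rwa [piece_self]
      exact ⟨v, hvv, (piece_piece hvv).symm⟩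
  rw [sumComp_eq_finsum_mem_range, hrange, finsum_mem_singleton]

/-- Replacing one component of `Z` by a smaller cycle changes only its contribution. -/
lemma sumComp_replace_piece [Fintype V] (F : (V → ℤ) → ℚ) {Z l : V → ℤ} {v : V}
    (hv : Z v ≠ 0) (hl : ∀ u, piece M Z v u = 0 → l u = 0) :
    sumComp M F (Z - piece M Z v + l) =
      sumComp M F Z - F (piece M Z v) + sumComp M F l := by
  have h₁ := (separated_sub_piece Z v hl).sumComp_add F
  have h₂ := (separated_sub_piece (M := M) Z v fun _ h => h).sumComp_add F
  rw [sub_add_cancel, sumComp_piece F hv] at h₂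
  rw [h₁, h₂]
  ring

lemma sumComp_zero [Fintype V] (F : (V → ℤ) → ℚ) : sumComp M F 0 = 0 := by
  have hrange : Set.range (compCycle M (0 : V → ℤ)) = ∅ := by
    simp [range_compCycle]
  rw [sumComp_eq_finsum_mem_range, hrange, finsum_mem_empty]

lemma sum_compCycle [Fintype V] (Z : V → ℤ) : ∑ c, toQ (compCycle M Z c) = toQ Z := by
  funext v
  rw [Finset.sum_apply]
  by_cases hv : Z v = 0
  · simp [toQ, compCycle, hv]
  · simp [toQ, compCycle, hv]

lemma pairQ_piece_self [Fintype V] (hoff : ∀ u v : V, u ≠ v → 0 ≤ M u v) (Z : V → ℤ) (w : V) :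
    pairQ M (toQ (piece M Z w)) (toQ (piece M Z w)) = pairQ M (toQ (piece M Z w)) (toQ Z) := by
  refine Finset.sum_congr rfl fun u _ => Finset.sum_congr rfl fun v _ => ?_
  by_cases hu : piece M Z w u = 0
  · simp [toQ, hu]
  by_cases hv : Linked M Z w v
  · simp [toQ, piece, hv]
  by_cases hZv : Z v = 0
  · simp [toQ, piece, hZv]
  have hlu := linked_of_piece_ne_zero M hu
  have hne : u ≠ v := fun h => hv (h ▸ hlu)
  have hM : M u v = 0 := by
    refine le_antisymm (not_lt.mp fun hpos => hv ?_) (hoff u v hne)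
    refine hlu.tail ⟨?_, piece_ne_zero M hu, hZv⟩
    exact (SimpleGraph.fromRel_adj _ _ _).mpr ⟨hne, Or.inl hpos⟩
  simp [hM]

/-- `χ(−l' + ·) − χ(−l')` is additive over connected components. -/
lemma sumComp_chiQ_sub [Fintype V] (hsym : ∀ u v, M u v = M v u)
    (hoff : ∀ u v : V, u ≠ v → 0 ≤ M u v) (ZK a : V → ℚ) (Z : V → ℤ) :
    sumComp M (fun W => chiQ M ZK (a + toQ W) - chiQ M ZK a) Z =
      chiQ M ZK (a + toQ Z) - chiQ M ZK a := by
  have hlin : ∀ y : V → ℤ, pairQ M (toQ y) (toQ y) = pairQ M (toQ y) (toQ Z) →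
      chiQ M ZK (a + toQ y) - chiQ M ZK a = pairQ M (toQ y) (-(toQ Z - ZK)) / 2
        - pairQ M (toQ y) a := by
    intro y hy
    rw [chiQ_add M hsym, pairQ_comm M hsym a]
    simp only [chiQ, sub_eq_add_neg, pairQ_neg_right, pairQ_add_right, hy]
    ring
  rw [sumComp, finsum_eq_sum_of_fintype, hlin Z rfl]
  rw [Finset.sum_congr rfl fun c _ => hlin (compCycle M Z c) ?_]
  · rw [Finset.sum_sub_distrib, ← Finset.sum_div, ← pairQ_sum_left, ← pairQ_sum_left,
      sum_compCycle]
  · obtain ⟨v, -, hv⟩ := exists_compCycle_eq_piece M Z c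
    rw [hv]
    exact pairQ_piece_self hoff Z v

end Components

/-- Lemma 6.6(b).  For every connected component `Z'_i` of a
`≤`-minimal maximizer `Z'`, one has `χ(Z'_i) = min_{0≤l≤Z'_i} χ(l)`. -/
theorem stmt_6
    (V : Type) [Fintype V] [DecidableEq V] [Nonempty V]
    (M : Matrix V V ℤ)
    (hsym : ∀ u v, M u v = M v u)
    (hneg : ∀ x : V → ℚ, x ≠ 0 → pairQ M x x < 0)
    (hoff : ∀ u v : V, u ≠ v → 0 ≤ M u v)
    (hconn : (dualGraph M).Connected)
    (ZK : V → ℚ)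
    (hZK : ∀ v, pairQ M ZK (Pi.single v 1) = (M v v : ℚ) + 2)
    (l' : V → ℚ)
    (hl' : ∀ v, ∃ n : ℕ, pairQ M l' (Pi.single v 1) = n)
    (Z : V → ℤ) (hZ : ∀ v, 1 ≤ Z v)
    (hnotdom : ∃ l : V → ℤ, 0 < l ∧ l ≤ Z ∧
      chiQ M ZK (-l' + toQ l) ≤ chiQ M ZK (-l'))
    -- `D` : the dominance defect
    (D : (V → ℤ) → ℚ)
    (hD0 : ∀ W : V → ℤ,
      (∀ l : V → ℤ, 0 < l → l ≤ W → chiQ M ZK (-l') < chiQ M ZK (-l' + toQ l)) →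
      D W = 0)
    (hD1 : ∀ W : V → ℤ,
      (∃ l : V → ℤ, 0 < l ∧ l ≤ W ∧ chiQ M ZK (-l' + toQ l) ≤ chiQ M ZK (-l')) →
      D W = 1)
    -- `μ W = min_{0 ≤ l ≤ W} χ(−l' + l)`
    (μ : (V → ℤ) → ℚ)
    (hμ : ∀ W : V → ℤ, 0 ≤ W →
      IsLeast {q : ℚ | ∃ l : V → ℤ, 0 ≤ l ∧ l ≤ W ∧
        q = chiQ M ZK (-l' + toQ l)} (μ W))
    -- `t = t(Z,l') = max_{0<Z''≤Z} Σ_i T(Z''_i,l')`, `T(W,l') = χ(−l') − μ W + D W`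
    (t : ℚ)
    (ht : IsGreatest {q : ℚ | ∃ W : V → ℤ, 0 < W ∧ W ≤ Z ∧
      q = sumComp M (fun W' => chiQ M ZK (-l') - μ W' + D W') W} t)
    -- `Z'` is a `≤`-minimal realizing cycle
    (Z' : V → ℤ) (hZ'pos : 0 < Z') (hZ'le : Z' ≤ Z)
    (hZ'max : sumComp M (fun W' => chiQ M ZK (-l') - μ W' + D W') Z' = t)
    (hZ'min : ∀ W : V → ℤ, 0 < W → W ≤ Z →
      sumComp M (fun W' => chiQ M ZK (-l') - μ W' + D W') W = t → W ≤ Z' → W = Z') :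
    ∀ c : (inducedOnSupp M Z').ConnectedComponent,
      IsLeast {q : ℚ | ∃ l : V → ℤ, 0 ≤ l ∧ l ≤ compCycle M Z' c ∧
          q = chiQ M ZK (toQ l)}
        (chiQ M ZK (toQ (compCycle M Z' c))) := by
  intro c
  obtain ⟨v, hv, hc⟩ := exists_compCycle_eq_piece M Z' c
  rw [hc]
  set A := piece M Z' v with hA
  set T : (V → ℤ) → ℚ := fun W' => chiQ M ZK (-l') - μ W' + D W' with hT
  set f : (V → ℤ) → ℚ := fun W => chiQ M ZK (-l' + toQ W) - chiQ M ZK (-l') with hf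
  have hD : ∀ W, D W = 0 ∨ D W = 1 := by
    intro W
    by_cases h : ∃ l : V → ℤ, 0 < l ∧ l ≤ W ∧ chiQ M ZK (-l' + toQ l) ≤ chiQ M ZK (-l')
    · exact Or.inr (hD1 W h)
    · push Not at h
      exact Or.inl (hD0 W h)
  have hμle : ∀ W : V → ℤ, 0 ≤ W → μ W ≤ chiQ M ZK (-l' + toQ W) := fun W hW =>
    (hμ W hW).2 ⟨W, hW, le_rfl, rfl⟩
  have hTge : ∀ W : V → ℤ, 0 ≤ W → -f W ≤ T W := by
    intro W hW
    have := hμle W hW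
    rcases hD W with h | h <;> simp only [hf, hT, h] <;> linarith
  have hTge_one : ∀ W : V → ℤ, 0 < W → f W ≤ 0 → 1 - f W ≤ T W := by
    intro W hW hfW
    have := hμle W hW.le
    have h := hD1 W ⟨W, hW, le_rfl, by simpa [hf] using hfW⟩
    simp only [hf, hT, h]
    linarith
  have hsum : ∀ l : V → ℤ, 0 < l → f l ≤ 0 → 1 - f l ≤ sumComp M T l := by
    intro l hl hfl
    have hcyc : ∀ d, 0 < compCycle M l d := by
      intro d
      obtain ⟨w, hw, hd⟩ := exists_compCycle_eq_piece M l d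
      rw [hd]
      refine (piece_nonneg M hl.le w).lt_of_ne fun h => hw ?_
      rw [← piece_self M l w, ← h, Pi.zero_apply]
    have hadd : ∑ d, f (compCycle M l d) = f l := by
      rw [← finsum_eq_sum_of_fintype]
      exact sumComp_chiQ_sub hsym hoff ZK (-l') l
    have hne : Nonempty (inducedOnSupp M l).ConnectedComponent := by
      obtain ⟨w, hw⟩ := Function.ne_iff.mp hl.ne'
      exact ⟨(inducedOnSupp M l).connectedComponentMk ⟨w, hw⟩⟩
    obtain ⟨d, -, hd⟩ : ∃ d ∈ Finset.univ, f (compCycle M l d) ≤ 0 := by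
      by_contra! h
      exact absurd (Finset.sum_pos h Finset.univ_nonempty) (by rw [hadd]; exact not_lt.mpr hfl)
    have hrest : ∑ e ∈ Finset.univ.erase d, -f (compCycle M l e) ≤
        ∑ e ∈ Finset.univ.erase d, T (compCycle M l e) :=
      Finset.sum_le_sum fun e _ => hTge _ (hcyc e).le
    have hd' := hTge_one _ (hcyc d) hd
    rw [sumComp, finsum_eq_sum_of_fintype, ← Finset.add_sum_erase _ _ (Finset.mem_univ d)]
    rw [← Finset.add_sum_erase _ _ (Finset.mem_univ d)] at hadd
    rw [Finset.sum_neg_distrib] at hrest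
    linarith
  have ht_pos : 1 ≤ t := by
    obtain ⟨l, hl, hlZ, hle⟩ := hnotdom
    have hfl : f l ≤ 0 := sub_nonpos.mpr hle
    have := ht.2 ⟨l, hl, hlZ, rfl⟩
    linarith [hsum l hl hfl]
  have hA0 : 0 ≤ A := piece_nonneg M hZ'pos.le v
  have hAle : A ≤ Z' := piece_le M hZ'pos.le v
  have hAv : A v ≠ 0 := by rwa [hA, piece_self]
  have hsupp : ∀ l : V → ℤ, 0 ≤ l → l ≤ A → ∀ u, A u = 0 → l u = 0 := fun l h0 hl u hu =>
    le_antisymm (hu ▸ hl u) (h0 u)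
  -- Lowering the component `A` to `l` without decreasing the sum forces `l = A`.
  have hmin : ∀ l : V → ℤ, 0 ≤ l → l ≤ A → T A ≤ sumComp M T l → l = A := by
    intro l h0 hl hTl
    have hrep := sumComp_replace_piece T hv (hsupp l h0 hl)
    rw [← hA, hZ'max] at hrep
    have hW0 : 0 ≤ Z' - A + l := add_nonneg (sub_nonneg.mpr hAle) h0
    have hWle : Z' - A + l ≤ Z' := by
      rw [sub_add, sub_le_self_iff]
      exact sub_nonneg.mpr hl
    have hWpos : 0 < Z' - A + l := by
      refine hW0.lt_of_ne fun h => ?_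
      rw [← h, sumComp_zero] at hrep
      linarith
    have hge : sumComp M T (Z' - A + l) ≤ t := ht.2 ⟨_, hWpos, hWle.trans hZ'le, rfl⟩
    have hEq := hZ'min _ hWpos (hWle.trans hZ'le) (by linarith) hWle
    have : A - l = 0 := by
      rw [sub_add] at hEq
      exact sub_eq_self.mp hEq
    exact (sub_eq_zero.mp this).symm
  obtain ⟨⟨l₀, hl₀, hl₀A, hl₀μ⟩, hμlb⟩ := hμ A hA0
  have hDA : ∃ l : V → ℤ, 0 < l ∧ l ≤ A ∧ chiQ M ZK (-l' + toQ l) ≤ chiQ M ZK (-l') := by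
    by_contra h
    push Not at h
    have hge : chiQ M ZK (-l') ≤ μ A := by
      rw [hl₀μ]
      rcases hl₀.eq_or_lt with h0 | h0
      · rw [← h0]
        have : toQ (0 : V → ℤ) = 0 := by ext; simp [toQ]
        simp [this]
      · exact (h l₀ h0 hl₀A).le
    have hTA : T A ≤ sumComp M T 0 := by
      rw [sumComp_zero]
      simp only [hT, hD0 A h]
      linarith
    exact hAv (congrFun (hmin 0 le_rfl hA0 hTA) v).symm
  have hTA : T A = 1 + chiQ M ZK (-l') - μ A := by
    simp only [hT, hD1 A hDA]
    ring
  have hAμ : chiQ M ZK (-l' + toQ A) = μ A := by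
    obtain ⟨l, hl, hlA, hlμ⟩ : ∃ l : V → ℤ, 0 < l ∧ l ≤ A ∧ chiQ M ZK (-l' + toQ l) = μ A := by
      obtain ⟨l₁, hl₁, hl₁A, hle⟩ := hDA
      rcases hl₀.eq_or_lt with h0 | h0
      · refine ⟨l₁, hl₁, hl₁A, le_antisymm ?_ (hμlb ⟨l₁, hl₁.le, hl₁A, rfl⟩)⟩
        have : toQ (0 : V → ℤ) = 0 := by ext; simp [toQ]
        rw [hl₀μ, ← h0, this, add_zero]
        exact hle
      · exact ⟨l₀, h0, hl₀A, hl₀μ.symm⟩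
    have hfl : f l ≤ 0 := by
      obtain ⟨l₁, hl₁, hl₁A, hle⟩ := hDA
      have := hμlb ⟨l₁, hl₁.le, hl₁A, rfl⟩
      simp only [hf, hlμ]
      linarith
    have hbound := hsum l hl hfl
    simp only [hf, hlμ] at hbound
    rwa [hmin l hl.le hlA (by linarith)] at hlμ
  refine ⟨⟨A, hA0, le_rfl, rfl⟩, ?_⟩
  rintro q ⟨l, h0, hl, rfl⟩
  have hle := hμlb ⟨l, h0, hl, rfl⟩
  have hnef : 0 ≤ pairQ M l' (toQ A - toQ l) := by
    refine pairQ_nonneg M (fun u => ?_) fun u => ?_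
    · obtain ⟨n, hn⟩ := hl' u
      exact hn ▸ n.cast_nonneg
    · simpa [toQ] using hl u
  rw [← hAμ] at hle
  simp only [chiQ_add M hsym, pairQ_neg_left] at hle
  rw [sub_eq_add_neg, pairQ_add_right, pairQ_neg_right] at hnef
  linarith
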